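/- arXiv:2306.13527 — 3 statements merged into one kernel-verified Lean document; each statement's English description precedes it below -/
import Mathlib

section
/- The set G^n_s belongs to the σ-algebra B, and μ(G^n_s) = 1. -/
noncomputable section
open Complex

/-- The ℓ¹ norm of an integer vector. -/
def norm1 {n : ℕ} (k : Fin n → ℤ) : ℕ := ∑ i, (k i).natAbs

/-- Integer vectors whose first nonzero component is positive. -/
def Zstar (n : ℕ) : Set (Fin n → ℤ) := {k | ∃ j, 0 < k j ∧ ∀ i, i < j → k i = 0}

/-- Generators of one-dimensional maximal lattices in ℤⁿ. -/
def gen (n : ℕ) : Set (Fin n → ℤ) :=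
  {k | k ∈ Zstar n ∧ Finset.univ.gcd (fun i => (k i).natAbs) = 1}

/-- Generators of size at most `K`. -/
def genK (n : ℕ) (K : ℝ) : Set (Fin n → ℤ) := {k | k ∈ gen n ∧ (norm1 k : ℝ) ≤ K}

/-- `c` is the family of Fourier coefficients of a zero-average real analytic
function in the closed unit ball of the norm `‖f‖ₛ = sup |f_k| e^{s|k|₁}`. -/
structure InBall (n : ℕ) (s : ℝ) (c : (Fin n → ℤ) → ℂ) : Prop where
  zero : c 0 = 0
  real : ∀ k, c (-k) = (starRingEnd ℂ) (c k)
  bound : ∀ k, ‖c k‖ * Real.exp (s * norm1 k) ≤ 1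

/-- The Fourier cut-off `N(δ)`. -/
def Ncut (n : ℕ) (s δ : ℝ) : ℝ :=
  2 * max 1 (1/s * Real.log (2^44 * (2*(n:ℝ) / Real.exp 1)^n / (s^n * δ)))

/-- Condition (P1+) with parameter δ. -/
def P1plus (n : ℕ) (s δ : ℝ) (c : (Fin n → ℤ) → ℂ) : Prop :=
  ∀ k ∈ gen n, Ncut n s δ ≤ (norm1 k : ℝ) →
    δ / (norm1 k : ℝ)^n * Real.exp (-(s * norm1 k)) ≤ ‖c k‖

/-- Complex extension of the Fourier projection `π_{ℤk} f` onto modes proportional to `k`. -/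
def projC {n : ℕ} (c : (Fin n → ℤ) → ℂ) (k : Fin n → ℤ) (θ : ℂ) : ℂ :=
  ∑' j : ℤ, if j = 0 then 0 else c (j • k) * Complex.exp (Complex.I * (j : ℂ) * θ)

/-- Real restriction of the Fourier projection `π_{ℤk} f`. -/
def projR {n : ℕ} (c : (Fin n → ℤ) → ℂ) (k : Fin n → ℤ) (θ : ℝ) : ℝ :=
  (projC c k (θ : ℂ)).re

/-- `F` is a `β`-Morse function on the torus `ℝ/2πℤ`. -/
def BetaMorse (β : ℝ) (F : ℝ → ℝ) : Prop :=
  (∀ θ : ℝ, β ≤ |deriv F θ| + |deriv (deriv F) θ|) ∧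
  (∀ θ₁ θ₂ : ℝ, deriv F θ₁ = 0 → deriv F θ₂ = 0 →
    (¬ ∃ m : ℤ, θ₁ - θ₂ = 2 * Real.pi * m) → β ≤ |F θ₁ - F θ₂|)

/-- `F` is a Morse function with distinct critical values on the torus `ℝ/2πℤ`. -/
def MorseWithDistinctValues (F : ℝ → ℝ) : Prop :=
  (∀ θ : ℝ, deriv F θ = 0 → deriv (deriv F) θ ≠ 0) ∧
  (∀ θ₁ θ₂ : ℝ, deriv F θ₁ = 0 → deriv F θ₂ = 0 → F θ₁ = F θ₂ →
    ∃ m : ℤ, θ₁ - θ₂ = 2 * Real.pi * m)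

/-- The liminf condition (P1): `liminf |f_k| e^{s|k|₁} |k|₁ⁿ > 0` along `k ∈ 𝒢ⁿ`. -/
def LiminfPos (n : ℕ) (s : ℝ) (c : (Fin n → ℤ) → ℂ) : Prop :=
  ∃ d : ℝ, 0 < d ∧ ∃ N : ℝ, ∀ k ∈ gen n, N ≤ (norm1 k : ℝ) →
    d ≤ ‖c k‖ * Real.exp (s * norm1 k) * (norm1 k : ℝ)^n

/-- The generic class `𝔾ⁿₛ` (in terms of Fourier coefficients). -/
def Gset (n : ℕ) (s : ℝ) : Set ((Fin n → ℤ) → ℂ) :=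
  {c | InBall n s c ∧ LiminfPos n s c ∧ ∀ k ∈ gen n, MorseWithDistinctValues (projR c k)}

/-- The class `𝔾ⁿₛ(δ,β)`. -/
def GsetDB (n : ℕ) (s δ β : ℝ) : Set ((Fin n → ℤ) → ℂ) :=
  {c | InBall n s c ∧ P1plus n s δ c ∧
    ∀ k ∈ gen n, (norm1 k : ℝ) ≤ Ncut n s δ → BetaMorse β (projR c k)}


open MeasureTheory
open scoped Classical

/-- The closed unit disc in ℂ. -/
abbrev Disc : Set ℂ := Metric.closedBall (0:ℂ) 1

/-- The index set `ℤⁿ_*` as a type. -/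
abbrev ZS (n : ℕ) := {k : Fin n → ℤ // k ∈ Zstar n}

/-- The product space `D^{ℤⁿ_*}` (with the product σ-algebra). -/
abbrev ProdSpace (n : ℕ) := ZS n → Disc

/-- Normalized Lebesgue measure on the closed unit disc. -/
def discMeasure : Measure Disc :=
  (volume Disc)⁻¹ • (Measure.comap Subtype.val volume)

/-- The inverse of the weighted Fourier bijection: recover the Fourier coefficients of
`f ∈ 𝔹ⁿₛ` from a point of `D^{ℤⁿ_*}` via `f_k = x_k e^{-s|k|₁}` for `k ∈ ℤⁿ_*` and
`f_{-k} = conj f_k`. -/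
def coeffOf (n : ℕ) (s : ℝ) (x : ProdSpace n) : (Fin n → ℤ) → ℂ :=
  fun k =>
    if h : k ∈ Zstar n then (x ⟨k, h⟩ : ℂ) * ((Real.exp (-(s * norm1 k)) : ℝ) : ℂ)
    else if h' : (-k) ∈ Zstar n then
      (starRingEnd ℂ) (x ⟨-k, h'⟩ : ℂ) * ((Real.exp (-(s * norm1 k)) : ℝ) : ℂ)
    else 0

/-- A map of the plane whose derivative kills the vertical direction on a set sends that set to a
null set. -/
lemma volume_image_eq_zero_of_vertical_deriv {f : ℂ → ℂ} {S : Set ℂ}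
    (hf : ∀ z ∈ S, DifferentiableAt ℝ f z)
    (h : ∀ z ∈ S, HasDerivAt (fun t : ℝ => f (z + t * I)) 0 0) :
    volume (f '' S) = 0 := by
  refine addHaar_image_eq_zero_of_det_fderivWithin_eq_zero volume
    (f' := fun z => fderiv ℝ f z) (fun z hz => (hf z hz).hasFDerivAt.hasFDerivWithinAt)
    fun z hz => ?_
  have hline : HasDerivAt (fun t : ℝ => z + t * I) I 0 := by
    simpa using ((Complex.ofRealCLM.hasDerivAt (x := (0 : ℝ))).mul_const I).const_add z
  have hd : HasFDerivAt f (fderiv ℝ f z) (z + ((0 : ℝ) : ℂ) * I) := by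
    simpa using (hf z hz).hasFDerivAt
  have h0 : fderiv ℝ f z I = 0 := (hd.comp_hasDerivAt (0 : ℝ) hline).unique (h z hz)
  change LinearMap.det (fderiv ℝ f z : ℂ →ₗ[ℝ] ℂ) = 0
  rw [LinearMap.det_eq_zero_iff_ker_ne_bot, Submodule.ne_bot_iff]
  exact ⟨I, by simpa using h0, I_ne_zero⟩

lemma re_mul_exp (a : ℝ) (c : ℂ) (θ : ℝ) :
    ((a : ℂ) * c * Complex.exp (I * θ)).re =
      a * (c.re * Real.cos θ - c.im * Real.sin θ) := by
  rw [mul_comm I, Complex.exp_mul_I]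
  simp [Complex.cos_ofReal_re, Complex.sin_ofReal_re]
  ring

lemma hasDerivAt_re_mul_exp (a : ℝ) (c : ℂ) (θ : ℝ) :
    HasDerivAt (fun t : ℝ => a * (c.re * Real.cos t - c.im * Real.sin t))
      (-a * (c.re * Real.sin θ + c.im * Real.cos θ)) θ := by
  exact ((((Real.hasDerivAt_cos θ).const_mul c.re).sub
    ((Real.hasDerivAt_sin θ).const_mul c.im)).const_mul a).congr_deriv (by ring)

/-- For the perturbations `G + a Re (c e^{iθ})`, the set of parameters `c` giving a degenerate
critical point is null. -/
lemma volume_degenerate_critical (G₁ G₂ G₃ : ℝ → ℝ) (h₁ : ∀ θ, HasDerivAt G₁ (G₂ θ) θ)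
    (h₂ : ∀ θ, HasDerivAt G₂ (G₃ θ) θ) {a : ℝ} (ha : a ≠ 0) :
    volume {c : ℂ | ∃ θ : ℝ, G₁ θ - a * (c.re * Real.sin θ + c.im * Real.cos θ) = 0 ∧
      G₂ θ - a * (c.re * Real.cos θ - c.im * Real.sin θ) = 0} = 0 := by
  set f : ℂ → ℂ := fun z => Complex.exp (-(I * (z.re : ℝ))) / a * (G₂ z.re + G₁ z.re * I)
    with hf
  have hd : Differentiable ℝ f := by
    have e₁ : Differentiable ℝ G₁ := fun θ => (h₁ θ).differentiableAt
    have e₂ : Differentiable ℝ G₂ := fun θ => (h₂ θ).differentiableAt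
    have r : Differentiable ℝ (fun z : ℂ => z.re) := Complex.reCLM.differentiable
    have o : Differentiable ℝ (fun x : ℝ => (x : ℂ)) := Complex.ofRealCLM.differentiable
    have o₁ := o.comp (e₁.comp r)
    have o₂ := o.comp (e₂.comp r)
    have o₃ := o.comp r
    simp only [Function.comp_def] at o₁ o₂ o₃
    fun_prop
  refine measure_mono_null (t := f '' Set.univ) ?_
    (volume_image_eq_zero_of_vertical_deriv (fun z _ => hd z) fun z _ => ?_)
  · rintro c ⟨θ, e₁, e₂⟩
    refine ⟨(θ : ℂ), trivial, ?_⟩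
    have haC : (a : ℂ) ≠ 0 := by exact_mod_cast ha
    have key : (G₂ θ + G₁ θ * I : ℂ) = a * c * Complex.exp (I * θ) := by
      have e₁' : G₁ θ = a * (c.re * Real.sin θ + c.im * Real.cos θ) := by linarith
      have e₂' : G₂ θ = a * (c.re * Real.cos θ - c.im * Real.sin θ) := by linarith
      rw [e₁', e₂', mul_comm I, Complex.exp_mul_I, ← Complex.ofReal_cos, ← Complex.ofReal_sin]
      apply Complex.ext <;> simp <;> ring
    simp only [hf, Complex.ofReal_re]
    rw [key, Complex.exp_neg]
    field_simp [Complex.exp_ne_zero]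
  · simpa [hf] using hasDerivAt_const (0 : ℝ) (f z)

/-- For the perturbations `G + a Re (c e^{iθ})`, the set of parameters `c` giving two critical
points with the same critical value is null. -/
lemma volume_equal_critical_values (G₀ G₁ G₂ : ℝ → ℝ) (h₀ : ∀ θ, HasDerivAt G₀ (G₁ θ) θ)
    (h₁ : ∀ θ, HasDerivAt G₁ (G₂ θ) θ) {a : ℝ} (ha : a ≠ 0) :
    volume {c : ℂ | ∃ θ φ : ℝ, Real.cos (φ - θ) ≠ 1 ∧
      G₁ θ - a * (c.re * Real.sin θ + c.im * Real.cos θ) = 0 ∧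
      G₁ φ - a * (c.re * Real.sin φ + c.im * Real.cos φ) = 0 ∧
      G₀ θ + a * (c.re * Real.cos θ - c.im * Real.sin θ) =
        G₀ φ + a * (c.re * Real.cos φ - c.im * Real.sin φ)} = 0 := by
  set u : ℝ → ℝ → ℝ := fun θ φ =>
    (G₀ φ - G₀ θ - G₁ θ * Real.sin (φ - θ)) / (1 - Real.cos (φ - θ)) with hu
  set f : ℂ → ℂ := fun z =>
    Complex.exp (-(I * (z.re : ℝ))) / a * (u z.re z.im + G₁ z.re * I) with hf
  set S : Set ℂ := {z | Real.cos (z.im - z.re) ≠ 1 ∧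
    G₁ z.im - u z.re z.im * Real.sin (z.im - z.re) - G₁ z.re * Real.cos (z.im - z.re) = 0}
    with hS
  refine measure_mono_null (t := f '' S) ?_
    (volume_image_eq_zero_of_vertical_deriv (fun z hz => ?_) fun z hz => ?_)
  · rintro c ⟨θ, φ, hne, e₁, e₂, e₃⟩
    have haC : (a : ℂ) ≠ 0 := by exact_mod_cast ha
    have hne' : 1 - Real.cos (φ - θ) ≠ 0 := sub_ne_zero.2 (Ne.symm hne)
    obtain ⟨δ, rfl⟩ : ∃ δ, φ = θ + δ := ⟨φ - θ, by ring⟩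
    simp only [add_sub_cancel_left] at hne hne'
    have sc := Real.sin_sq_add_cos_sq θ
    have e₁' : G₁ θ = a * (c.re * Real.sin θ + c.im * Real.cos θ) := by linarith
    have hu' : u θ (θ + δ) = a * (c.re * Real.cos θ - c.im * Real.sin θ) := by
      simp only [hu, add_sub_cancel_left]
      rw [div_eq_iff hne', e₁']
      rw [Real.cos_add, Real.sin_add] at e₃
      linear_combination -e₃
    refine ⟨⟨θ, θ + δ⟩, ⟨by simpa using hne, ?_⟩, ?_⟩
    · simp only [add_sub_cancel_left]
      rw [hu', e₁']
      rw [Real.cos_add, Real.sin_add] at e₂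
      linear_combination e₂
    · have key : (u θ (θ + δ) + G₁ θ * I : ℂ) = a * c * Complex.exp (I * θ) := by
        rw [e₁', hu', mul_comm I, Complex.exp_mul_I, ← Complex.ofReal_cos, ← Complex.ofReal_sin]
        apply Complex.ext <;> simp <;> ring
      simp only [hf]
      rw [key, Complex.exp_neg]
      field_simp [Complex.exp_ne_zero]
  · have hne : 1 - Real.cos (z.im - z.re) ≠ 0 := sub_ne_zero.2 (Ne.symm hz.1)
    have e₀ : Differentiable ℝ G₀ := fun θ => (h₀ θ).differentiableAt
    have e₁ : Differentiable ℝ G₁ := fun θ => (h₁ θ).differentiableAt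
    have r : Differentiable ℝ (fun z : ℂ => z.re) := Complex.reCLM.differentiable
    have i : Differentiable ℝ (fun z : ℂ => z.im) := Complex.imCLM.differentiable
    have o : Differentiable ℝ (fun x : ℝ => (x : ℂ)) := Complex.ofRealCLM.differentiable
    have r₀ := e₀.comp r
    have r₁ := e₁.comp r
    have i₀ := e₀.comp i
    have hu : DifferentiableAt ℝ (fun z : ℂ => u z.re z.im) z := by
      simp only [Function.comp_def] at r₀ r₁ i₀
      have num : DifferentiableAt ℝ (fun z : ℂ =>
        G₀ z.im - G₀ z.re - G₁ z.re * Real.sin (z.im - z.re)) z := by fun_prop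
      have den : DifferentiableAt ℝ (fun z : ℂ => 1 - Real.cos (z.im - z.re)) z := by fun_prop
      simp only [u, div_eq_mul_inv]
      exact num.fun_mul (den.fun_inv hne)
    have o₁ := (o _).comp z hu
    have o₂ := o.comp r₁
    have o₃ := o.comp r
    simp only [Function.comp_def] at o₁ o₂ o₃
    fun_prop
  · have hne : 1 - Real.cos (z.im - z.re) ≠ 0 := sub_ne_zero.2 (Ne.symm hz.1)
    have hδ : HasDerivAt (fun t : ℝ => z.im + t - z.re) 1 0 :=
      ((hasDerivAt_id (0 : ℝ)).const_add _).sub_const _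
    have hφ : HasDerivAt (fun t : ℝ => z.im + t) 1 0 := (hasDerivAt_id (0 : ℝ)).const_add _
    have hG : HasDerivAt (fun t : ℝ => G₀ (z.im + t)) (G₁ (z.im + 0) * 1) 0 :=
      (h₀ (z.im + 0)).comp (0 : ℝ) hφ
    have hu0 : HasDerivAt (fun t : ℝ => u z.re (z.im + t)) 0 0 := by
      refine ((((hG.sub_const (G₀ z.re)).sub (hδ.sin.const_mul (G₁ z.re)))).div
        (hδ.cos.const_sub 1) (by simpa using hne)).congr_deriv ?_
      rw [div_eq_zero_iff]
      left
      have h2 := hz.2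
      simp only [hu] at h2
      field_simp at h2
      simp only [add_zero, mul_one, Pi.sub_apply]
      linear_combination h2
    have := ((hu0.ofReal_comp).add_const (G₁ z.re * I : ℂ)).const_mul
      (Complex.exp (-(I * (z.re : ℝ))) / a)
    simpa [hf] using this

lemma hasDerivAt_re_mul_exp' (a : ℝ) (c : ℂ) (θ : ℝ) :
    HasDerivAt (fun t : ℝ => -a * (c.re * Real.sin t + c.im * Real.cos t))
      (-a * (c.re * Real.cos θ - c.im * Real.sin θ)) θ :=
  ((((Real.hasDerivAt_sin θ).const_mul c.re).add
    ((Real.hasDerivAt_cos θ).const_mul c.im)).const_mul (-a)).congr_deriv (by ring)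

lemma cos_sub_eq_one_iff (θ φ : ℝ) :
    Real.cos (φ - θ) = 1 ↔ ∃ m : ℤ, θ - φ = 2 * Real.pi * m := by
  rw [← Real.cos_neg, neg_sub, Real.cos_eq_one_iff]
  exact exists_congr fun m => by rw [eq_comm, mul_comm]

lemma morseWithDistinctValues_iff {F F' F'' : ℝ → ℝ} (h : ∀ θ, HasDerivAt F (F' θ) θ)
    (h' : ∀ θ, HasDerivAt F' (F'' θ) θ) :
    MorseWithDistinctValues F ↔ ¬ ((∃ θ, F' θ = 0 ∧ F'' θ = 0) ∨
      ∃ θ φ, Real.cos (φ - θ) ≠ 1 ∧ F' θ = 0 ∧ F' φ = 0 ∧ F θ = F φ) := by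
  have e : deriv F = F' := funext fun θ => (h θ).deriv
  have e' : deriv F' = F'' := funext fun θ => (h' θ).deriv
  simp only [MorseWithDistinctValues, e, e', ← cos_sub_eq_one_iff]
  grind

/-- Adding a generic first harmonic turns a smooth function into a Morse function with distinct
critical values. -/
lemma volume_not_morseWithDistinctValues (G₀ G₁ G₂ G₃ : ℝ → ℝ)
    (h₀ : ∀ θ, HasDerivAt G₀ (G₁ θ) θ) (h₁ : ∀ θ, HasDerivAt G₁ (G₂ θ) θ)
    (h₂ : ∀ θ, HasDerivAt G₂ (G₃ θ) θ) {a : ℝ} (ha : a ≠ 0) :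
    volume {c : ℂ | ¬ MorseWithDistinctValues
      (fun θ => G₀ θ + ((a : ℂ) * c * Complex.exp (I * θ)).re)} = 0 := by
  refine measure_mono_null ?_ (measure_union_null (volume_degenerate_critical G₁ G₂ G₃ h₁ h₂ ha)
    (volume_equal_critical_values G₀ G₁ G₂ h₀ h₁ ha))
  intro c hc
  simp only [Set.mem_ofPred_eq, re_mul_exp] at hc
  rw [morseWithDistinctValues_iff (fun θ => (h₀ θ).fun_add (hasDerivAt_re_mul_exp a c θ))
    (fun θ => (h₁ θ).fun_add (hasDerivAt_re_mul_exp' a c θ)), not_not] at hc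
  simpa only [neg_mul, ← sub_eq_add_neg, Set.mem_union, Set.mem_ofPred_eq] using hc

/-- The `m`-th derivative of the `j`-th mode of the trigonometric series with coefficients `a`. -/
def modeDeriv (a : ℤ → ℂ) (m : ℕ) (j : ℤ) (θ : ℝ) : ℝ :=
  ((I * j) ^ m * (if j = 0 then 0 else a j) * Complex.exp (I * j * θ)).re

lemma norm_modeDeriv_le {a : ℤ → ℂ} {s : ℝ} (ha : ∀ j, ‖a j‖ ≤ Real.exp (-(s * |(j : ℝ)|)))
    (m : ℕ) (j : ℤ) (θ : ℝ) :
    ‖modeDeriv a m j θ‖ ≤ |(j : ℝ)| ^ m * Real.exp (-(s * |(j : ℝ)|)) := by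
  refine (Complex.abs_re_le_norm _).trans ?_
  have h : ‖Complex.exp (I * j * θ)‖ = 1 := by
    rw [Complex.norm_exp]; simp
  rw [norm_mul, h, mul_one, norm_mul, norm_pow, norm_mul, Complex.norm_I, one_mul,
    Complex.norm_intCast]
  gcongr
  split_ifs
  · simpa using (Real.exp_pos _).le
  · exact ha j

lemma summable_abs_pow_mul_exp {s : ℝ} (hs : 0 < s) (m : ℕ) :
    Summable fun j : ℤ => |(j : ℝ)| ^ m * Real.exp (-(s * |(j : ℝ)|)) := by
  have := Real.summable_pow_mul_exp_neg_nat_mul m hs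
  refine Summable.of_nat_of_neg ?_ ?_ <;> simpa using this

lemma hasDerivAt_modeDeriv (a : ℤ → ℂ) (m : ℕ) (j : ℤ) (θ : ℝ) :
    HasDerivAt (modeDeriv a m j) (modeDeriv a (m + 1) j θ) θ := by
  have h₀ : HasDerivAt (fun t : ℝ => I * j * (t : ℂ)) (I * j) θ := by
    simpa using (Complex.ofRealCLM.hasDerivAt (x := θ)).const_mul (I * j : ℂ)
  have h := Complex.reCLM.hasFDerivAt.comp_hasDerivAt θ
    (h₀.cexp.const_mul ((I * j) ^ m * (if j = 0 then 0 else a j)))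
  refine h.congr_deriv ?_
  simp only [Complex.reCLM_apply, modeDeriv]
  congr 1
  ring

/-- The `m`-th derivative of the trigonometric series with coefficients `a` and zero average. -/
def seriesDeriv (a : ℤ → ℂ) (m : ℕ) (θ : ℝ) : ℝ := ∑' j : ℤ, modeDeriv a m j θ

lemma summable_modeDeriv {a : ℤ → ℂ} {s : ℝ} (hs : 0 < s)
    (ha : ∀ j, ‖a j‖ ≤ Real.exp (-(s * |(j : ℝ)|))) (m : ℕ) (θ : ℝ) :
    Summable fun j => modeDeriv a m j θ :=
  .of_norm_bounded (summable_abs_pow_mul_exp hs m) fun j => norm_modeDeriv_le ha m j θ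

lemma hasDerivAt_seriesDeriv {a : ℤ → ℂ} {s : ℝ} (hs : 0 < s)
    (ha : ∀ j, ‖a j‖ ≤ Real.exp (-(s * |(j : ℝ)|))) (m : ℕ) (θ : ℝ) :
    HasDerivAt (seriesDeriv a m) (seriesDeriv a (m + 1) θ) θ :=
  hasDerivAt_tsum (summable_abs_pow_mul_exp hs (m + 1)) (fun j y => hasDerivAt_modeDeriv a m j y)
    (fun j y => norm_modeDeriv_le ha (m + 1) j y) (summable_modeDeriv hs ha m 0) θ

lemma continuous_seriesDeriv {X : Type*} [TopologicalSpace X] {a : X → ℤ → ℂ} {s : ℝ}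
    (hs : 0 < s) (ha : ∀ x j, ‖a x j‖ ≤ Real.exp (-(s * |(j : ℝ)|)))
    (hc : ∀ j, Continuous fun x => a x j) (m : ℕ) :
    Continuous fun p : X × ℝ => seriesDeriv (a p.1) m p.2 := by
  refine continuous_tsum (fun j => ?_) (summable_abs_pow_mul_exp hs m)
    fun j p => norm_modeDeriv_le (ha p.1) m j p.2
  have := hc j
  unfold modeDeriv
  split_ifs <;> fun_prop

lemma projR_eq_seriesDeriv {n : ℕ} {c : (Fin n → ℤ) → ℂ} {k : Fin n → ℤ} {s : ℝ} (hs : 0 < s)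
    (hc : ∀ j : ℤ, ‖c (j • k)‖ ≤ Real.exp (-(s * |(j : ℝ)|))) :
    projR c k = seriesDeriv (fun j => c (j • k)) 0 := by
  funext θ
  have hsum : Summable fun j : ℤ =>
      if j = 0 then 0 else c (j • k) * Complex.exp (Complex.I * (j : ℂ) * (θ : ℂ)) := by
    refine .of_norm_bounded (summable_abs_pow_mul_exp hs 0) fun j => ?_
    have h : ‖Complex.exp (I * j * θ)‖ = 1 := by
      rw [Complex.norm_exp]; simp
    split_ifs
    · simpa using (Real.exp_pos _).le
    · rw [norm_mul, h, mul_one, pow_zero, one_mul]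
      exact hc j
  rw [projR, projC, Complex.re_tsum hsum, seriesDeriv]
  refine tsum_congr fun j => ?_
  unfold modeDeriv
  split_ifs <;> simp

section Coefficients

variable {n : ℕ} {s : ℝ}

lemma norm1_neg (k : Fin n → ℤ) : norm1 (-k) = norm1 k := by
  simp [norm1]

lemma norm1_zsmul (j : ℤ) (k : Fin n → ℤ) : norm1 (j • k) = j.natAbs * norm1 k := by
  simp [norm1, Int.natAbs_mul, Finset.mul_sum]

lemma neg_notMem_Zstar {k : Fin n → ℤ} (hk : k ∈ Zstar n) : -k ∉ Zstar n := by
  rintro ⟨j', hj', h'⟩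
  obtain ⟨j, hj, h⟩ := hk
  simp only [Pi.neg_apply] at hj' h'
  rcases lt_trichotomy j j' with hlt | rfl | hlt
  · have := h' j hlt; lia
  · lia
  · have := h j' hlt; lia

lemma zero_notMem_Zstar : (0 : Fin n → ℤ) ∉ Zstar n := fun ⟨_, h, _⟩ => lt_irrefl _ h

lemma zsmul_mem_Zstar {j : ℤ} (hj : 0 < j) {k : Fin n → ℤ} (hk : k ∈ Zstar n) :
    j • k ∈ Zstar n := by
  obtain ⟨i, hi, h⟩ := hk
  exact ⟨i, by simpa using mul_pos hj hi, fun l hl => by simp [h l hl]⟩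

lemma norm1_pos {k : Fin n → ℤ} (hk : k ∈ Zstar n) : 0 < norm1 k := by
  obtain ⟨i, hi, -⟩ := hk
  exact Finset.sum_pos' (fun _ _ => Nat.zero_le _) ⟨i, Finset.mem_univ i, by lia⟩

lemma coeffOf_of_mem (x : ProdSpace n) {k : Fin n → ℤ} (hk : k ∈ Zstar n) :
    coeffOf n s x k = (x ⟨k, hk⟩ : ℂ) * ((Real.exp (-(s * norm1 k)) : ℝ) : ℂ) := by
  simp [coeffOf, hk]

lemma coeffOf_neg (x : ProdSpace n) (k : Fin n → ℤ) :
    coeffOf n s x (-k) = (starRingEnd ℂ) (coeffOf n s x k) := by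
  by_cases hk : k ∈ Zstar n
  · simp [coeffOf, hk, neg_notMem_Zstar hk, norm1_neg, ← Complex.exp_conj]
  · by_cases hk' : -k ∈ Zstar n
    · simp [coeffOf, hk, hk', norm1_neg, ← Complex.exp_conj]
    · simp [coeffOf, hk, hk']

lemma norm_coeffOf_le (x : ProdSpace n) (k : Fin n → ℤ) :
    ‖coeffOf n s x k‖ ≤ Real.exp (-(s * norm1 k)) := by
  have hx (l : ZS n) : ‖(x l : ℂ)‖ ≤ 1 := mem_closedBall_zero_iff.1 (x l).2
  have he : ‖((Real.exp (-(s * norm1 k)) : ℝ) : ℂ)‖ = Real.exp (-(s * norm1 k)) := by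
    rw [Complex.norm_real, Real.norm_of_nonneg (Real.exp_pos _).le]
  unfold coeffOf
  split_ifs
  · rw [norm_mul, he]
    exact mul_le_of_le_one_left (Real.exp_pos _).le (hx _)
  · rw [norm_mul, he, Complex.norm_conj]
    exact mul_le_of_le_one_left (Real.exp_pos _).le (hx _)
  · simpa using (Real.exp_pos _).le

lemma inBall_coeffOf (x : ProdSpace n) : InBall n s (coeffOf n s x) where
  zero := by simp [coeffOf, zero_notMem_Zstar]
  real := coeffOf_neg x
  bound k := by
    refine (mul_le_mul_of_nonneg_right (norm_coeffOf_le x k) (Real.exp_pos _).le).trans ?_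
    rw [← Real.exp_add, neg_add_cancel, Real.exp_zero]

lemma norm_coeffOf_mul_exp (x : ProdSpace n) {k : Fin n → ℤ} (hk : k ∈ Zstar n) :
    ‖coeffOf n s x k‖ * Real.exp (s * norm1 k) = ‖(x ⟨k, hk⟩ : ℂ)‖ := by
  rw [coeffOf_of_mem x hk, norm_mul, Complex.norm_real, Real.norm_of_nonneg (Real.exp_pos _).le,
    mul_assoc, ← Real.exp_add, neg_add_cancel, Real.exp_zero, mul_one]

lemma continuous_coeffOf (k : Fin n → ℤ) : Continuous fun x => coeffOf n s x k := by
  unfold coeffOf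
  split_ifs <;> fun_prop

lemma norm_coeffOf_zsmul_le (hs : 0 < s) (x : ProdSpace n) {k : Fin n → ℤ} (hk : k ∈ Zstar n)
    (j : ℤ) : ‖coeffOf n s x (j • k)‖ ≤ Real.exp (-(s * |(j : ℝ)|)) := by
  refine (norm_coeffOf_le x _).trans ?_
  have h1 : (1 : ℝ) ≤ norm1 k := by exact_mod_cast norm1_pos hk
  have : |(j : ℝ)| ≤ (norm1 (j • k) : ℝ) := by
    rw [norm1_zsmul, Nat.cast_mul, Nat.cast_natAbs, Int.cast_abs]
    exact le_mul_of_one_le_right (abs_nonneg _) h1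
  gcongr

lemma morse_coeffOf_iff (hs : 0 < s) (x : ProdSpace n) {k : Fin n → ℤ} (hk : k ∈ Zstar n) :
    MorseWithDistinctValues (projR (coeffOf n s x) k) ↔
      let D := seriesDeriv fun j => coeffOf n s x (j • k)
      ¬ ((∃ θ, D 1 θ = 0 ∧ D 2 θ = 0) ∨
        ∃ θ φ, Real.cos (φ - θ) ≠ 1 ∧ D 1 θ = 0 ∧ D 1 φ = 0 ∧ D 0 θ = D 0 φ) := by
  have ha := norm_coeffOf_zsmul_le hs x hk
  rw [projR_eq_seriesDeriv hs ha]
  exact morseWithDistinctValues_iff (hasDerivAt_seriesDeriv hs ha 0)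
    (hasDerivAt_seriesDeriv hs ha 1)

end Coefficients

/-- Projections along a σ-compact factor of closed sets over a compact space are Borel. -/
lemma measurableSet_fst_image {X Y : Type*} [TopologicalSpace X] [CompactSpace X] [T2Space X]
    [MeasurableSpace X] [BorelSpace X] [TopologicalSpace Y] [SigmaCompactSpace Y]
    {S : Set (X × Y)} (hS : IsClosed S) : MeasurableSet (Prod.fst '' S) := by
  obtain ⟨K, hK, hU⟩ :=
    (isSigmaCompact_univ.of_isClosed_subset hS (Set.subset_univ S)).image continuous_fst
  rw [← hU]
  exact .iUnion fun i => (hK i).isClosed.measurableSet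

section Genericity

variable {n : ℕ} {s : ℝ}

lemma measurableSet_morse (hs : 0 < s) {k : Fin n → ℤ} (hk : k ∈ Zstar n) :
    MeasurableSet {x : ProdSpace n | MorseWithDistinctValues (projR (coeffOf n s x) k)} := by
  set D : ℕ → ProdSpace n × ℝ → ℝ := fun m p =>
    seriesDeriv (fun j => coeffOf n s p.1 (j • k)) m p.2 with hD
  have hc (m : ℕ) : Continuous (D m) :=
    continuous_seriesDeriv (a := fun (x : ProdSpace n) j => coeffOf n s x (j • k)) hs
      (fun x j => norm_coeffOf_zsmul_le hs x hk j) (fun j => continuous_coeffOf (j • k)) m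
  have hc₁ (m : ℕ) : Continuous fun p : ProdSpace n × (ℝ × ℝ) => D m (p.1, p.2.1) :=
    (hc m).comp (by fun_prop)
  have hc₂ (m : ℕ) : Continuous fun p : ProdSpace n × (ℝ × ℝ) => D m (p.1, p.2.2) :=
    (hc m).comp (by fun_prop)
  have hcos : Continuous fun p : ProdSpace n × (ℝ × ℝ) => 1 - Real.cos (p.2.2 - p.2.1) := by
    fun_prop
  have hdeg : IsClosed {p | D 1 p = 0 ∧ D 2 p = 0} :=
    (isClosed_eq (hc 1) continuous_const).inter (isClosed_eq (hc 2) continuous_const)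
  have heq (N : ℕ) : IsClosed {p : ProdSpace n × (ℝ × ℝ) |
      1 / ((N : ℝ) + 1) ≤ 1 - Real.cos (p.2.2 - p.2.1) ∧ D 1 (p.1, p.2.1) = 0 ∧
        D 1 (p.1, p.2.2) = 0 ∧ D 0 (p.1, p.2.1) = D 0 (p.1, p.2.2)} :=
    (isClosed_le continuous_const hcos).inter
      ((isClosed_eq (hc₁ 1) continuous_const).inter
        ((isClosed_eq (hc₂ 1) continuous_const).inter (isClosed_eq (hc₁ 0) (hc₂ 0))))
  convert ((measurableSet_fst_image hdeg).union
    (MeasurableSet.iUnion fun N => measurableSet_fst_image (heq N))).compl using 1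
  ext x
  simp only [Set.mem_ofPred_eq, morse_coeffOf_iff hs x hk, Set.mem_compl_iff, Set.mem_union,
    Set.mem_iUnion, Set.mem_image, Prod.exists, exists_and_right, exists_eq_right]
  refine not_congr (or_congr Iff.rfl ⟨?_, ?_⟩)
  · rintro ⟨θ, φ, hne, h⟩
    obtain ⟨N, hN⟩ := exists_nat_one_div_lt (sub_pos.2 ((Real.cos_le_one _).lt_of_ne hne))
    exact ⟨N, θ, φ, hN.le, h⟩
  · rintro ⟨N, θ, φ, hN, h⟩
    refine ⟨θ, φ, fun h1 => ?_, h⟩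
    rw [h1, sub_self] at hN
    exact absurd hN (not_le.2 (by positivity))

lemma measurableSet_liminfPos :
    MeasurableSet {x : ProdSpace n | LiminfPos n s (coeffOf n s x)} := by
  have : {x : ProdSpace n | LiminfPos n s (coeffOf n s x)} =
      ⋃ (i : ℕ) (N : ℕ), ⋂ (k : Fin n → ℤ) (_ : k ∈ gen n) (_ : (N : ℝ) ≤ norm1 k),
        {x | 1 / ((i : ℝ) + 1) ≤
          ‖coeffOf n s x k‖ * Real.exp (s * norm1 k) * (norm1 k : ℝ) ^ n} := by
    ext x
    simp only [LiminfPos, Set.mem_ofPred_eq, Set.mem_iUnion, Set.mem_iInter]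
    constructor
    · rintro ⟨d, hd, N, h⟩
      obtain ⟨i, hi⟩ := exists_nat_one_div_lt hd
      obtain ⟨M, hM⟩ := exists_nat_ge N
      exact ⟨i, M, fun k hk hkM => hi.le.trans (h k hk (hM.trans hkM))⟩
    · rintro ⟨i, N, h⟩
      exact ⟨_, by positivity, N, h⟩
  rw [this]
  refine .iUnion fun i => .iUnion fun N => .iInter fun k => .iInter fun _ => .iInter fun _ => ?_
  have := continuous_coeffOf (s := s) k
  exact measurableSet_le measurable_const (by fun_prop)

lemma discMeasure_apply (t : Set Disc) :
    discMeasure t = (volume Disc)⁻¹ * volume (Subtype.val '' t) := by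
  rw [discMeasure, Measure.smul_apply, smul_eq_mul,
    comap_subtype_coe_apply Metric.isClosed_closedBall.measurableSet]

instance : IsProbabilityMeasure discMeasure where
  measure_univ := by
    rw [discMeasure_apply, Set.image_univ, Subtype.range_coe]
    refine ENNReal.inv_mul_cancel (Metric.measure_closedBall_pos _ _ one_pos).ne' ?_
    exact measure_closedBall_lt_top.ne

lemma discMeasure_preimage_null {N : Set ℂ} (hN : volume N = 0) :
    discMeasure {c | (c : ℂ) ∈ N} = 0 := by
  have hsub : Subtype.val '' {c : Disc | (c : ℂ) ∈ N} ⊆ N := by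
    rintro _ ⟨c, hc, rfl⟩
    exact hc
  rw [discMeasure_apply, measure_mono_null hsub hN, mul_zero]

lemma discMeasure_norm_lt_le {r : ℝ} (hr : 0 ≤ r) :
    discMeasure {c | ‖(c : ℂ)‖ < r} ≤ ENNReal.ofReal (r ^ 2) := by
  have hsub : Subtype.val '' {c : Disc | ‖(c : ℂ)‖ < r} ⊆ Metric.ball (0 : ℂ) r := by
    rintro _ ⟨c, hc, rfl⟩
    exact mem_ball_zero_iff.2 hc
  rw [discMeasure_apply]
  refine (mul_le_mul_right (measure_mono hsub) _).trans_eq ?_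
  rw [Complex.volume_ball, Complex.volume_closedBall, ENNReal.ofReal_one, one_pow, one_mul,
    mul_comm, mul_assoc, ENNReal.mul_inv_cancel (by simp [NNReal.pi_ne_zero]) ENNReal.coe_ne_top,
    mul_one, ENNReal.ofReal_pow hr]

lemma summable_norm1_inv_pow (hn : 1 ≤ n) :
    Summable fun k : Fin n → ℤ => ((norm1 k : ℝ)⁻¹) ^ (2 * n) := by
  set L := Submodule.span ℤ (Set.range (Pi.basisFun ℝ (Fin n))) with hL
  have hfr : Module.finrank ℤ L = n := by
    rw [ZLattice.rank ℝ L]; simp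
  have hmem (k : Fin n → ℤ) : (fun i => (k i : ℝ)) ∈ L :=
    (Module.Basis.mem_span_iff_repr_mem ℤ (Pi.basisFun ℝ (Fin n)) _).2 fun i => ⟨k i, by simp⟩
  have hinj : Function.Injective fun k : Fin n → ℤ => (⟨fun i => (k i : ℝ), hmem k⟩ : L) := by
    intro k l h
    funext i
    exact Int.cast_injective (congrFun (congrArg Subtype.val h) i)
  have hsum := (ZLattice.summable_norm_pow_inv L (2 * n) (by lia)).comp_injective hinj
  refine .of_nonneg_of_le (fun k => by positivity) (fun k => ?_) hsum
  simp only [Function.comp_apply, Submodule.coe_norm]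
  by_cases hk : k = 0
  · subst hk
    simp [norm1, show n ≠ 0 by lia]
  have hpos : 0 < ‖(fun i => (k i : ℝ))‖ := by
    rw [norm_pos_iff]
    contrapose! hk
    funext i
    simpa using congrFun hk i
  have hle : ‖(fun i => (k i : ℝ))‖ ≤ norm1 k := by
    refine (pi_norm_le_iff_of_nonneg (Nat.cast_nonneg _)).2 fun i => ?_
    rw [Real.norm_eq_abs, ← Int.cast_abs, ← Nat.cast_natAbs]
    exact_mod_cast Finset.single_le_sum (f := fun i => (k i).natAbs)
      (fun _ _ => Nat.zero_le _) (Finset.mem_univ i)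
  gcongr

lemma coeffOf_update_of_pos (x : ProdSpace n) {k : Fin n → ℤ} (hk : k ∈ Zstar n) (c : Disc)
    {j : ℤ} (hj : 0 < j) :
    coeffOf n s (Function.update x ⟨k, hk⟩ c) (j • k) =
      coeffOf n s (Function.update x ⟨k, hk⟩ ⟨0, by simp⟩) (j • k) +
        if j = 1 then (c : ℂ) * ((Real.exp (-(s * norm1 k)) : ℝ) : ℂ) else 0 := by
  by_cases h1 : j = 1
  · subst h1
    simp [coeffOf, hk]
  · have hne : (⟨j • k, zsmul_mem_Zstar hj hk⟩ : ZS n) ≠ ⟨k, hk⟩ := by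
      intro h
      have := congrArg norm1 (congrArg Subtype.val h)
      rw [norm1_zsmul] at this
      have h2 := (Nat.mul_eq_right (norm1_pos hk).ne').1 this
      lia
    simp only [coeffOf_of_mem _ (zsmul_mem_Zstar hj hk), Function.update_of_ne hne, h1, if_false,
      add_zero]

/-- The coordinate of index `k` contributes to the projection on `ℤk` a pure first harmonic. -/
lemma projR_coeffOf_update (hs : 0 < s) (x : ProdSpace n) {k : Fin n → ℤ} (hk : k ∈ Zstar n)
    (c : Disc) (θ : ℝ) :
    projR (coeffOf n s (Function.update x ⟨k, hk⟩ c)) k θ =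
      seriesDeriv (fun j => coeffOf n s (Function.update x ⟨k, hk⟩ ⟨0, by simp⟩) (j • k)) 0 θ +
        (((2 * Real.exp (-(s * norm1 k)) : ℝ) : ℂ) * c * Complex.exp (I * θ)).re := by
  set w : ℂ := (c : ℂ) * ((Real.exp (-(s * norm1 k)) : ℝ) : ℂ) with hw
  set b : ℤ → ℂ := fun j => if j = 1 then w else if j = -1 then (starRingEnd ℂ) w else 0 with hb
  set a₀ : ℤ → ℂ := fun j => coeffOf n s (Function.update x ⟨k, hk⟩ ⟨0, by simp⟩) (j • k)
  have hsplit (j : ℤ) : coeffOf n s (Function.update x ⟨k, hk⟩ c) (j • k) = a₀ j + b j := by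
    rcases lt_trichotomy j 0 with hj | rfl | hj
    · have h := coeffOf_update_of_pos (s := s) x hk c (neg_pos.2 hj)
      simp only [neg_smul, coeffOf_neg] at h
      have h' := congrArg (starRingEnd ℂ) h
      rw [map_add, Complex.conj_conj, Complex.conj_conj] at h'
      rw [h', hb]
      simp only [neg_eq_iff_eq_neg, show j ≠ 1 by lia, if_false, a₀]
      split_ifs <;> simp [hw]
    · simp [a₀, hb, coeffOf, zero_notMem_Zstar]
    · simp only [coeffOf_update_of_pos x hk c hj, hb, show j ≠ -1 by lia, if_false, a₀, hw]
  have hmode (j : ℤ) : modeDeriv (fun j => coeffOf n s (Function.update x ⟨k, hk⟩ c) (j • k)) 0 j θ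
      = modeDeriv a₀ 0 j θ + modeDeriv b 0 j θ := by
    unfold modeDeriv
    simp only [← Complex.add_re, hsplit]
    congr 1
    split_ifs <;> ring
  have hzero : ∀ j ∉ ({1, -1} : Finset ℤ), modeDeriv b 0 j θ = 0 := by
    intro j hj
    simp only [Finset.mem_insert, Finset.mem_singleton, not_or] at hj
    simp [modeDeriv, hb, hj.1, hj.2]
  rw [projR_eq_seriesDeriv hs (norm_coeffOf_zsmul_le hs _ hk), seriesDeriv, tsum_congr hmode,
    (summable_modeDeriv hs (norm_coeffOf_zsmul_le hs _ hk) 0 θ).tsum_add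
      (summable_of_ne_finset_zero hzero), tsum_eq_sum hzero, ← seriesDeriv]
  congr 1
  rw [Finset.sum_pair (by decide)]
  have hconj : (starRingEnd ℂ) w * Complex.exp (I * ((-1 : ℤ) : ℂ) * θ) =
      (starRingEnd ℂ) (w * Complex.exp (I * θ)) := by
    rw [map_mul (starRingEnd ℂ) w, ← Complex.exp_conj]; simp
  have h1 : modeDeriv b 0 1 θ = (w * Complex.exp (I * θ)).re := by
    simp [modeDeriv, hb]
  have h2 : modeDeriv b 0 (-1) θ = (w * Complex.exp (I * θ)).re := by
    rw [← Complex.conj_re (w * Complex.exp (I * θ)), ← hconj]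
    simp [modeDeriv, hb]
  rw [h1, h2, hw, ← two_mul, ← Complex.re_ofReal_mul]
  congr 1
  push_cast
  ring

/-- The measures on the product space with the cylinder values of the product measure are
invariant under resampling one coordinate. -/
lemma map_update_prod_discMeasure (μ : Measure (ProdSpace n)) [IsProbabilityMeasure μ]
    (hcyl : ∀ (F : Finset (ZS n)) (A : ZS n → Set Disc), (∀ k, MeasurableSet (A k)) →
      μ {x : ProdSpace n | ∀ k ∈ F, x k ∈ A k} = ∏ k ∈ F, discMeasure (A k)) (k : ZS n) :
    (μ.prod discMeasure).map (fun p => Function.update p.1 k p.2) = μ := by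
  have hmeas : Measurable fun p : ProdSpace n × Disc => Function.update p.1 k p.2 := by
    refine measurable_pi_lambda _ fun i => ?_
    by_cases h : i = k
    · subst h; simpa using measurable_snd
    · simp only [Function.update_of_ne h]; fun_prop
  have hμ : μ = Measure.infinitePi fun _ => discMeasure :=
    Measure.eq_infinitePi _ fun F A hA => hcyl F A hA
  conv_rhs => rw [hμ]
  refine Measure.eq_infinitePi _ fun F A hA => ?_
  rw [Measure.map_apply hmeas (.pi F.countable_toSet fun i _ => hA i)]
  have hrect (F : Finset (ZS n)) (B : Set Disc) :
      (μ.prod discMeasure) ({x : ProdSpace n | ∀ i ∈ F, x i ∈ A i} ×ˢ B) =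
        (∏ i ∈ F, discMeasure (A i)) * discMeasure B := by
    rw [Measure.prod_prod, hcyl F A hA]
  by_cases hk : k ∈ F
  · rw [← Finset.prod_erase_mul _ _ hk, ← hrect]
    congr 1
    ext p
    simp only [Set.mem_preimage, Set.mem_pi, Finset.mem_coe, Set.mem_prod, Set.mem_ofPred_eq,
      Finset.mem_erase]
    constructor
    · intro h
      exact ⟨fun i hi => by simpa [hi.1] using h i hi.2, by simpa using h k hk⟩
    · rintro ⟨h, h'⟩ i hi
      by_cases hik : i = k
      · subst hik; simpa using h'
      · simpa [hik] using h i ⟨hik, hi⟩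
  · rw [← mul_one (∏ i ∈ F, _), ← measure_univ (μ := discMeasure), ← hrect]
    congr 1
    ext p
    simp only [Set.mem_preimage, Set.mem_pi, Finset.mem_coe, Set.mem_prod, Set.mem_ofPred_eq,
      Set.mem_univ, and_true]
    refine forall₂_congr fun i hi => ?_
    rw [Function.update_of_ne (ne_of_mem_of_not_mem hi hk)]

lemma ae_morse (hs : 0 < s) (μ : Measure (ProdSpace n)) [IsProbabilityMeasure μ]
    (hcyl : ∀ (F : Finset (ZS n)) (A : ZS n → Set Disc), (∀ k, MeasurableSet (A k)) →
      μ {x : ProdSpace n | ∀ k ∈ F, x k ∈ A k} = ∏ k ∈ F, discMeasure (A k))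
    {k : Fin n → ℤ} (hk : k ∈ Zstar n) :
    ∀ᵐ x ∂μ, MorseWithDistinctValues (projR (coeffOf n s x) k) := by
  have hmeas : Measurable fun p : ProdSpace n × Disc => Function.update p.1 ⟨k, hk⟩ p.2 := by
    refine measurable_pi_lambda _ fun i => ?_
    by_cases h : i = ⟨k, hk⟩
    · subst h; simpa using measurable_snd
    · simp only [Function.update_of_ne h]; fun_prop
  have hB := (measurableSet_morse hs hk).compl
  change μ {x | MorseWithDistinctValues (projR (coeffOf n s x) k)}ᶜ = 0
  rw [← map_update_prod_discMeasure μ hcyl ⟨k, hk⟩, Measure.map_apply hmeas hB,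
    Measure.measure_prod_null (hmeas hB)]
  refine .of_forall fun x => ?_
  have ha := norm_coeffOf_zsmul_le hs (Function.update x ⟨k, hk⟩ ⟨0, by simp⟩) hk
  have hnull := volume_not_morseWithDistinctValues _ _ _ _ (hasDerivAt_seriesDeriv hs ha 0)
    (hasDerivAt_seriesDeriv hs ha 1) (hasDerivAt_seriesDeriv hs ha 2)
    (a := 2 * Real.exp (-(s * norm1 k))) (by positivity)
  refine (measure_mono_null ?_ (discMeasure_preimage_null hnull))
  intro c hc
  simp only [Set.mem_preimage, Set.mem_compl_iff, Set.mem_ofPred_eq] at hc ⊢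
  rwa [funext (projR_coeffOf_update hs x hk c)] at hc

lemma ae_liminfPos (hn : 1 ≤ n) (μ : Measure (ProdSpace n))
    (hcyl : ∀ (F : Finset (ZS n)) (A : ZS n → Set Disc), (∀ k, MeasurableSet (A k)) →
      μ {x : ProdSpace n | ∀ k ∈ F, x k ∈ A k} = ∏ k ∈ F, discMeasure (A k)) :
    ∀ᵐ x ∂μ, LiminfPos n s (coeffOf n s x) := by
  set A : ZS n → Set Disc := fun k => {c | ‖(c : ℂ)‖ < ((norm1 k.1 : ℝ)⁻¹) ^ n} with hA
  have hAm (k : ZS n) : MeasurableSet (A k) :=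
    measurableSet_lt (by fun_prop) measurable_const
  have hμ (k : ZS n) : μ {x | x k ∈ A k} ≤ ENNReal.ofReal (((norm1 k.1 : ℝ)⁻¹) ^ (2 * n)) := by
    have := hcyl {k} A hAm
    simp only [Finset.mem_singleton, forall_eq, Finset.prod_singleton] at this
    rw [this, mul_comm 2, pow_mul]
    exact discMeasure_norm_lt_le (by positivity)
  have hsum : ∑' k : ZS n, μ {x | x k ∈ A k} ≠ ⊤ := by
    refine ((ENNReal.tsum_le_tsum hμ).trans_lt ?_).ne
    exact ((summable_norm1_inv_pow hn).comp_injective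
      Subtype.val_injective).tsum_ofReal_lt_top
  filter_upwards [ae_finite_setOfPred_mem hsum] with x hx
  obtain ⟨N, hN⟩ := (hx.image fun k => norm1 k.1).bddAbove
  refine ⟨1, one_pos, (N : ℝ) + 1, fun k hk hkN => ?_⟩
  rw [norm_coeffOf_mul_exp x hk.1]
  have hnot : ¬ x ⟨k, hk.1⟩ ∈ A ⟨k, hk.1⟩ := by
    intro h
    have : norm1 k ≤ N := hN ⟨⟨k, hk.1⟩, h, rfl⟩
    have : (norm1 k : ℝ) ≤ N := by exact_mod_cast this
    linarith
  have hpos : (0 : ℝ) < norm1 k := by exact_mod_cast norm1_pos hk.1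
  simp only [hA, Set.mem_ofPred_eq, not_lt, inv_pow] at hnot
  exact (inv_le_iff_one_le_mul₀ (by positivity)).1 hnot

end Genericity

/-- `𝔾ⁿₛ` is measurable for the product σ-algebra and has measure 1 for the
product probability measure whose factors are normalized Lebesgue measure on the disc. -/
theorem stmt_6 (n : ℕ) (hn : 1 ≤ n) (s : ℝ) (hs : 0 < s)
    (μ : Measure (ProdSpace n)) [IsProbabilityMeasure μ]
    (hcyl : ∀ (F : Finset (ZS n)) (A : ZS n → Set Disc),
      (∀ k, MeasurableSet (A k)) →
      μ {x : ProdSpace n | ∀ k ∈ F, x k ∈ A k} = ∏ k ∈ F, discMeasure (A k)) :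
    MeasurableSet {x : ProdSpace n | coeffOf n s x ∈ Gset n s} ∧
    μ {x : ProdSpace n | coeffOf n s x ∈ Gset n s} = 1 := by
  have hset : {x : ProdSpace n | coeffOf n s x ∈ Gset n s} =
      {x | LiminfPos n s (coeffOf n s x)} ∩
        ⋂ (k : Fin n → ℤ) (_ : k ∈ gen n),
          {x | MorseWithDistinctValues (projR (coeffOf n s x) k)} := by
    ext x
    simp [Gset, inBall_coeffOf x]
  refine ⟨?_, ?_⟩
  · rw [hset]
    exact measurableSet_liminfPos.inter
      (.iInter fun k => .iInter fun hk => measurableSet_morse hs hk.1)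
  · have hae : ∀ᵐ x ∂μ, coeffOf n s x ∈ Gset n s := by
      have hM : ∀ᵐ x ∂μ, ∀ k ∈ gen n, MorseWithDistinctValues (projR (coeffOf n s x) k) :=
        ae_all_iff.2 fun k => ae_all_iff.2 fun hk => ae_morse hs μ hcyl hk.1
      filter_upwards [ae_liminfPos hn μ hcyl, hM] with x h₁ h₂
      exact ⟨inBall_coeffOf x, h₁, h₂⟩
    rw [measure_congr (Filter.eventuallyEq_univ.2 hae), measure_univ]

end
end

section
/- Let β>0 and let G:T→R be a C², β-Morse function. Then G has finitely many critical points, and their number is at most π·√(2·max_T|G''| / β). -/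
/-- A quadratic bound on the oscillation of a function between a critical point and a point to its
right, in terms of a bound on the second derivative. -/
theorem abs_sub_le_of_deriv_eq_zero {G : ℝ → ℝ} (hG : ContDiff ℝ 2 G) {M : ℝ}
    (hM : ∀ θ, |deriv (deriv G) θ| ≤ M) {x y : ℝ} (hy : deriv G y = 0) (hyx : y ≤ x) :
    |G x - G y| ≤ M / 2 * (x - y) ^ 2 := by
  have hG1 : Differentiable ℝ G := hG.differentiable (by norm_num)
  have hG2 : Differentiable ℝ (deriv G) :=
    (hG.iterate_deriv' 1 1).differentiable (by norm_num)
  have hbound : ∀ t ∈ Set.Ico y x, ‖deriv G t‖ ≤ M * (t - y) := by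
    intro t ht
    have := convex_univ.norm_image_sub_le_of_norm_deriv_le (f := deriv G) (C := M)
      (fun z _ => hG2 z) (fun z _ => hM z) (Set.mem_univ y) (Set.mem_univ t)
    rwa [hy, sub_zero, Real.norm_of_nonneg (sub_nonneg.2 ht.1)] at this
  have hB : ∀ t : ℝ, HasDerivAt (fun t => M / 2 * (t - y) ^ 2) (M * (t - y)) t := by
    intro t
    have := (((hasDerivAt_id t).sub_const y).pow 2).const_mul (M / 2)
    refine this.congr_deriv ?_
    simp
    ring
  have := image_norm_le_of_norm_deriv_right_le_deriv_boundary (f := fun t => G t - G y)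
    (f' := deriv G) (a := y) (b := x)
    (hG1.continuous.sub continuous_const).continuousOn
    (fun t _ => ((hG1 t).hasDerivAt.sub_const _).hasDerivWithinAt)
    (B := fun t => M / 2 * (t - y) ^ 2) (B' := fun t => M * (t - y)) (by simp) hB hbound
    (Set.right_mem_Icc.2 hyx)
  exact this

/-- A `d`-separated finite subset of `[a, b]` has at most `(b - a) / d + 1` elements. -/
theorem Finset.card_mul_le_of_separated {d : ℝ} (S : Finset ℝ)
    (hS : ∀ x ∈ S, ∀ y ∈ S, x < y → d ≤ y - x) {a b : ℝ} (hab : a ≤ b + d)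
    (ha : ∀ x ∈ S, a ≤ x) (hb : ∀ x ∈ S, x ≤ b) : (S.card : ℝ) * d ≤ b - a + d := by
  induction S using Finset.induction_on_max generalizing b with
  | empty => simp; linarith
  | insert c S hc ih =>
    have hcS : c ∉ S := fun h => lt_irrefl c (hc c h)
    have hcb := hb c (Finset.mem_insert_self c S)
    have := ih (b := b - d)
      (fun x hx y hy => hS x (Finset.mem_insert_of_mem hx) y (Finset.mem_insert_of_mem hy))
      (by linarith [ha c (Finset.mem_insert_self c S)])
      (fun x hx => ha x (Finset.mem_insert_of_mem hx))
      (fun x hx => by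
        have := hS x (Finset.mem_insert_of_mem hx) c (Finset.mem_insert_self c S) (hc x hx)
        linarith)
    rw [Finset.card_insert_of_notMem hcS]
    push_cast
    linarith

/-- A continuous periodic real function with nonzero period has bounded absolute value. -/
theorem Function.Periodic.bddAbove_range_abs {f : ℝ → ℝ} {c : ℝ} (hf : Function.Periodic f c)
    (hc : c ≠ 0) (hcont : Continuous f) : BddAbove (Set.range fun x => |f x|) := by
  have := (hf.comp fun y : ℝ => |y|).compact_of_continuous hc hcont.abs
  exact this.bddAbove

theorem stmt_7 (β : ℝ) (hβ : 0 < β) (G : ℝ → ℝ)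
    (hper : Function.Periodic G (2 * Real.pi)) (hG : ContDiff ℝ 2 G)
    (hM : BetaMorse β G) :
    Set.Finite {θ ∈ Set.Ico (0:ℝ) (2 * Real.pi) | deriv G θ = 0} ∧
    ({θ ∈ Set.Ico (0:ℝ) (2 * Real.pi) | deriv G θ = 0}.ncard : ℝ) ≤
      Real.pi * Real.sqrt (2 * (⨆ θ : ℝ, |deriv (deriv G) θ|) / β) := by
  have hpi := Real.pi_gt_three
  have hper' : ∀ f : ℝ → ℝ, Function.Periodic f (2 * Real.pi) →
      Function.Periodic (deriv f) (2 * Real.pi) := by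
    intro f hf x
    rw [← deriv_comp_add_const, hf.funext]
  have hcont : Continuous (deriv (deriv G)) := (hG.iterate_deriv' 0 2).continuous
  have hbdd := (hper' _ (hper' _ hper)).bddAbove_range_abs (by positivity) hcont
  set M := ⨆ θ : ℝ, |deriv (deriv G) θ|
  have hle : ∀ θ, |deriv (deriv G) θ| ≤ M := fun θ => le_ciSup hbdd θ
  set C := {θ ∈ Set.Ico (0:ℝ) (2 * Real.pi) | deriv G θ = 0}
  rcases C.eq_empty_or_nonempty with hemp | ⟨θ₀, hθ₀⟩
  · rw [hemp]
    simp
    positivity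
  have hβM : β ≤ M := by
    have := hM.1 θ₀
    rw [hθ₀.2, abs_zero, zero_add] at this
    exact this.trans (hle θ₀)
  have hMpos : 0 < M := hβ.trans_le hβM
  set s := Real.sqrt (2 * M / β)
  have hs : s ^ 2 = 2 * M / β := Real.sq_sqrt (by positivity)
  have hspos : 0 < s := Real.sqrt_pos.2 (by positivity)
  have hs1 : 1 ≤ s := Real.one_le_sqrt.2 ((one_le_div hβ).2 (by linarith))
  have hsep : ∀ x y, deriv G x = 0 → deriv G y = 0 → x < y →
      (¬ ∃ m : ℤ, x - y = 2 * Real.pi * m) → 2 / s ≤ y - x := by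
    intro x y hx hy hxy hne
    have h1 := hM.2 x y hx hy hne
    rw [abs_sub_comm] at h1
    have h2 := h1.trans (abs_sub_le_of_deriv_eq_zero hG hle hx hxy.le)
    refine (sq_le_sq₀ (by positivity) (sub_nonneg.2 hxy.le)).1 ?_
    rw [div_pow, hs, div_le_iff₀ (by positivity), ← mul_div_assoc, le_div_iff₀ hβ]
    nlinarith
  have hncong : ∀ x y : ℝ, 0 < y - x → y - x < 2 * Real.pi →
      ¬ ∃ m : ℤ, x - y = 2 * Real.pi * m := by
    rintro x y h1 h2 ⟨m, hm⟩
    have h3 : (m : ℝ) < 0 := by nlinarith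
    have h4 : (-1 : ℝ) < m := by nlinarith
    have h5 : m < 0 := by exact_mod_cast h3
    have h6 : -1 < m := by exact_mod_cast h4
    omega
  have hsepC : ∀ x ∈ C, ∀ y ∈ C, x < y → 2 / s ≤ y - x := fun x hx y hy hxy =>
    hsep x y hx.2 hy.2 hxy
      (hncong x y (sub_pos.2 hxy) (by linarith [hx.1.1, hy.1.2]))
  have hfin : C.Finite := by
    by_contra hinf
    obtain ⟨n, hn⟩ := exists_nat_gt ((2 * Real.pi - 0 + 2 / s) / (2 / s))
    obtain ⟨S, hSC, hcard⟩ := Set.Infinite.exists_subset_card_eq hinf n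
    have := S.card_mul_le_of_separated (d := 2 / s) (a := 0) (b := 2 * Real.pi)
      (fun x hx y hy => hsepC x (hSC hx) y (hSC hy)) (by positivity)
      (fun x hx => (hSC hx).1.1) (fun x hx => (hSC hx).1.2.le)
    rw [div_lt_iff₀ (by positivity), ← hcard] at hn
    linarith
  refine ⟨hfin, ?_⟩
  rw [Set.ncard_eq_toFinset_card C hfin]
  set S := hfin.toFinset
  have hSC : ∀ x, x ∈ S ↔ x ∈ C := fun x => hfin.mem_toFinset
  have hSne : S.Nonempty := ⟨θ₀, (hSC _).2 hθ₀⟩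
  set a := S.min' hSne
  have haC : a ∈ C := (hSC _).1 (S.min'_mem hSne)
  rcases le_or_gt S.card 1 with hcard | hcard
  · have : (S.card : ℝ) ≤ 1 := by exact_mod_cast hcard
    nlinarith
  have hup : ∀ x ∈ C, x ≠ a → x ≤ a + 2 * Real.pi - 2 / s := by
    intro x hx hxa
    have hax : a < x := lt_of_le_of_ne (S.min'_le x ((hSC x).2 hx)) hxa.symm
    have := hsep x (a + 2 * Real.pi) hx.2 (by rw [hper' G hper a, haC.2])
      (by linarith [hx.1.2, haC.1.1])
      (hncong _ _ (by linarith [hx.1.2, haC.1.1]) (by linarith))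
    linarith
  obtain ⟨b, hbS, hba⟩ := S.exists_mem_ne hcard a
  have hab : a ≤ b := S.min'_le b hbS
  have hb := hup b ((hSC b).1 hbS) hba
  have := S.card_mul_le_of_separated (d := 2 / s) (a := a) (b := a + 2 * Real.pi - 2 / s)
    (fun x hx y hy => hsepC x ((hSC x).1 hx) y ((hSC y).1 hy)) (by linarith)
    (fun x hx => S.min'_le x hx)
    (fun x hx => by
      by_cases hxa : x = a
      · rw [hxa]; exact hab.trans hb
      · exact hup x ((hSC x).1 hx) hxa)
  rw [show a + 2 * Real.pi - 2 / s - a + 2 / s = 2 * Real.pi by ring, ← mul_div_assoc,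
    div_le_iff₀ hspos] at this
  linarith
end

section
/- Let n≥2 and k∈G^n. Then there exists a matrix Â∈Z^{(n−1)×n} such that the n×n integer matrix A whose first row is k and whose remaining n−1 rows form Â satisfies: A∈SL(n,Z) (integer entries and det A = 1), |Â|_∞ ≤ |k|_∞, |A|_∞ = |k|_∞, and |A^{−1}|_∞ ≤ (n−1)^{(n−1)/2} |k|_∞^{n−1}. -/
/-- The sup norm `|k|_∞` of an integer vector. -/
def kinf {n : ℕ} (k : Fin n → ℤ) : ℕ := Finset.univ.sup fun i => (k i).natAbs

open Matrix

/-- **Hadamard's inequality** for a real matrix with entries bounded by `K`. -/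
theorem det_sq_le_of_abs_le {m : ℕ} (M : Matrix (Fin m) (Fin m) ℝ) (K : ℝ)
    (h : ∀ i j, |M i j| ≤ K) : M.det ^ 2 ≤ (m * K ^ 2) ^ m := by
  rcases m.eq_zero_or_pos with rfl | hm
  · simp
  have hP := posSemidef_self_mul_conjTranspose M
  have hdet : M.det ^ 2 = ∏ i, hP.isHermitian.eigenvalues i := by
    have := hP.isHermitian.det_eq_prod_eigenvalues
    simp only [det_mul, det_conjTranspose, star_trivial, RCLike.ofReal_real_eq_id, id] at this
    rw [← this, sq]
  have htr : ∑ i, hP.isHermitian.eigenvalues i ≤ m * (m * K ^ 2) := by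
    have := hP.isHermitian.trace_eq_sum_eigenvalues
    simp only [RCLike.ofReal_real_eq_id, id] at this
    rw [← this]
    calc (M * Mᴴ).trace = ∑ i, ∑ j, M i j ^ 2 := by
          simp [trace, mul_apply, sq]
      _ ≤ ∑ _i : Fin m, ∑ _j : Fin m, K ^ 2 :=
          Finset.sum_le_sum fun i _ => Finset.sum_le_sum fun j _ =>
            sq_le_sq' (abs_le.1 (h i j)).1 (abs_le.1 (h i j)).2
      _ = _ := by simp
  have hm' : (0 : ℝ) < m := by exact_mod_cast hm
  have hnn : 0 ≤ ∏ i, hP.isHermitian.eigenvalues i :=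
    Finset.prod_nonneg fun i _ => hP.eigenvalues_nonneg i
  have hamgm := Real.geom_mean_le_arith_mean Finset.univ (fun _ => 1)
    hP.isHermitian.eigenvalues (by simp) (by simpa using hm)
    (fun i _ => hP.eigenvalues_nonneg i)
  simp only [Real.rpow_one, Finset.sum_const, Finset.card_univ, Fintype.card_fin, nsmul_eq_mul,
    mul_one, one_mul] at hamgm
  have hle := hamgm.trans ((div_le_iff₀' hm').2 htr)
  calc M.det ^ 2 = ((∏ i, hP.isHermitian.eigenvalues i) ^ (m : ℝ)⁻¹) ^ m := by
        rw [Real.rpow_inv_natCast_pow hnn hm.ne', hdet]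
    _ ≤ _ := pow_le_pow_left₀ (Real.rpow_nonneg hnn _) hle m

theorem abs_det_le_rpow_of_abs_le {m : ℕ} (M : Matrix (Fin m) (Fin m) ℝ) {K : ℝ}
    (hK : 0 ≤ K) (h : ∀ i j, |M i j| ≤ K) : |M.det| ≤ (m : ℝ) ^ ((m : ℝ) / 2) * K ^ m := by
  refine abs_le_of_sq_le_sq ?_ (by positivity)
  refine (det_sq_le_of_abs_le M K h).trans_eq ?_
  have : ((m : ℝ) ^ ((m : ℝ) / 2)) ^ 2 = (m : ℝ) ^ m := by
    rw [← Real.rpow_mul_natCast (by positivity), ← Real.rpow_natCast]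
    congr 1
    push_cast
    ring
  rw [mul_pow, mul_pow, this]
  ring

theorem exists_bezout_abs_le {c d : ℤ} (hd : 0 ≤ d) (h : IsCoprime c d) :
    ∃ x y : ℤ, c * y - x * d = 1 ∧ |x| ≤ max 1 |c| ∧ |y| ≤ max 1 d := by
  obtain ⟨a, b, hab⟩ := h
  rcases hd.eq_or_lt with rfl | hd
  · have hc : IsUnit c := .of_mul_eq_one a (by linarith)
    exact ⟨0, c, by rcases Int.isUnit_iff.1 hc with rfl | rfl <;> simp,
      by simp, by rcases Int.isUnit_iff.1 hc with rfl | rfl <;> simp⟩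
  have h0 := Int.emod_nonneg a hd.ne'
  have h1 := Int.emod_lt_of_pos a hd
  have hxy : c * (a % d) - (-b - c * (a / d)) * d = 1 := by
    linear_combination c * Int.emod_add_mul_ediv a d + hab
  refine ⟨-b - c * (a / d), a % d, hxy, ?_, ?_⟩
  · generalize -b - c * (a / d) = x at hxy
    generalize a % d = y at *
    refine le_of_mul_le_mul_right ?_ hd
    have hx : |x| * d = |c * y - 1| := by
      rw [show c * y - 1 = x * d by linarith, abs_mul, abs_of_pos hd]
    have h2 : |c * y - 1| ≤ |c| * y + 1 := by
      calc |c * y - 1| ≤ |c * y| + |1| := abs_sub _ _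
        _ = _ := by rw [abs_mul, abs_of_nonneg h0, abs_one]
    rw [hx]
    nlinarith [le_max_left 1 |c|, le_max_right 1 |c|, abs_nonneg c]
  · rw [abs_of_nonneg h0]
    exact h1.le.trans (le_max_right _ _)

theorem one_le_of_isUnit_of_abs_le {ι : Type*} {k : ι → ℤ} {K : ℤ} [Nonempty ι]
    (hk : ∀ d, (∀ i, d ∣ k i) → IsUnit d) (hK : ∀ i, |k i| ≤ K) : 1 ≤ K := by
  by_contra! hlt
  refine not_isUnit_zero (hk 0 fun i => ?_)
  have := abs_nonneg (k i)
  have := hK i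
  rw [abs_eq_zero.1 (by omega : |k i| = 0)]

/-- An integer vector is a nonnegative multiple of a primitive vector. -/
theorem exists_eq_mul_primitive {n : ℕ} (k : Fin (n + 1) → ℤ) :
    ∃ (d : ℤ) (u : Fin (n + 1) → ℤ), 0 ≤ d ∧ (∀ i, k i = d * u i) ∧
      (∀ e, (∀ i, e ∣ u i) → IsUnit e) ∧ (d = 0 → ∀ i, u i = 1) := by
  by_cases h : Finset.univ.gcd k = 0
  · refine ⟨0, 1, le_rfl, fun i => ?_, fun e he => isUnit_of_dvd_one (he 0), fun _ _ => rfl⟩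
    simpa using Finset.gcd_eq_zero_iff.1 h i (Finset.mem_univ i)
  · obtain ⟨u, hu, hu1⟩ := Finset.extract_gcd k Finset.univ_nonempty
    refine ⟨Finset.univ.gcd k, u, ?_, fun i => hu i (Finset.mem_univ i), fun e he => ?_,
      fun h0 => absurd h0 h⟩
    · rw [← Finset.normalize_gcd]
      exact Int.nonneg_of_normalize_eq_self (normalize_idem _)
    · exact isUnit_of_dvd_one (hu1 ▸ Finset.dvd_gcd fun i _ => he i)

/-- A primitive integer vector is the first row of an integer matrix with determinant `±1`
whose entries are no larger than those of the vector. -/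
theorem exists_isUnit_det_of_primitive : ∀ (n : ℕ) (k : Fin (n + 1) → ℤ) (K : ℤ),
    (∀ d, (∀ i, d ∣ k i) → IsUnit d) → (∀ i, |k i| ≤ K) →
    ∃ A : Matrix (Fin (n + 1)) (Fin (n + 1)) ℤ,
      A 0 = k ∧ IsUnit A.det ∧ ∀ i j, |A i j| ≤ K
  | 0, k, K, hk, hK => by
    refine ⟨of fun _ => k, rfl, ?_, fun _ => hK⟩
    rw [det_fin_one]
    exact hk _ fun i => by rw [Fin.fin_one_eq_zero i, of_apply]
  | n + 1, k, K, hk, hK => by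
    have hK1 := one_le_of_isUnit_of_abs_le hk hK
    obtain ⟨d, u, hd, hku, hu, hd0⟩ := exists_eq_mul_primitive (fun i => k i.succ)
    have hcop : IsCoprime (k 0) d := isRelPrime_iff_isCoprime.1 fun e he0 hed =>
      hk e (Fin.cases he0 fun i => (hku i).symm ▸ hed.mul_right _)
    obtain ⟨x, y, hxy, hx, hy⟩ := exists_bezout_abs_le hd hcop
    have hyu (i) (z : ℤ) (hz : |z| ≤ max 1 d) : |z * u i| ≤ K := by
      rcases hd.eq_or_lt with h0 | hpos
      · rw [hd0 h0.symm i, mul_one]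
        rw [← h0] at hz
        exact hz.trans (by simpa using hK1)
      · rw [max_eq_right (by omega)] at hz
        calc |z * u i| = |z| * |u i| := abs_mul _ _
          _ ≤ d * |u i| := by gcongr
          _ = |k i.succ| := by rw [hku, abs_mul, abs_of_pos hpos]
          _ ≤ K := hK _
    obtain ⟨A, hA0, hA, hAK⟩ := exists_isUnit_det_of_primitive n u K hu
      fun i => by simpa using hyu i 1 (by simp)
    refine ⟨of (Fin.cons k (Fin.cons (Fin.cons x (y • u)) fun i => Fin.cons 0 (A i.succ))),
      rfl, ?_, ?_⟩
    · have hrow (z : ℤ) : (A.updateRow 0 (z • u)).det = z * A.det := by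
        rw [det_updateRow_smul, ← hA0, updateRow_eq_self]
      convert hA using 1
      rw [det_succ_column_zero, Fin.sum_univ_succ, Fin.sum_univ_succ]
      have e0 : (of (Fin.cons k (Fin.cons (Fin.cons x (y • u)) fun i => Fin.cons 0 (A i.succ))) :
          Matrix (Fin (n + 2)) (Fin (n + 2)) ℤ).submatrix (Fin.succAbove 0) Fin.succ =
          A.updateRow 0 (y • u) := by
        ext i j
        refine Fin.cases ?_ (fun i => ?_) i <;> simp
      have e1 : (of (Fin.cons k (Fin.cons (Fin.cons x (y • u)) fun i => Fin.cons 0 (A i.succ))) :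
          Matrix (Fin (n + 2)) (Fin (n + 2)) ℤ).submatrix (Fin.succAbove (Fin.succ 0)) Fin.succ =
          A.updateRow 0 (d • u) := by
        ext i j
        refine Fin.cases ?_ (fun i => ?_) i <;> simp [hku]
      rw [e0, e1, hrow, hrow]
      simp
      linear_combination A.det * hxy
    · refine Fin.cases hK (Fin.cases (Fin.cases ?_ fun j => ?_) fun i => Fin.cases ?_ fun j => ?_)
      · exact hx.trans (max_le hK1 (hK 0))
      · exact hyu j y hy
      · simpa using zero_le_one.trans hK1
      · exact hAK _ _

theorem exists_det_eq_one_of_primitive {n : ℕ} (k : Fin (n + 2) → ℤ) (K : ℤ)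
    (hk : ∀ d, (∀ i, d ∣ k i) → IsUnit d) (hK : ∀ i, |k i| ≤ K) :
    ∃ A : Matrix (Fin (n + 2)) (Fin (n + 2)) ℤ,
      A 0 = k ∧ A.det = 1 ∧ ∀ i j, |A i j| ≤ K := by
  obtain ⟨A, hA0, hA, hAK⟩ := exists_isUnit_det_of_primitive (n + 1) k K hk hK
  rcases Int.isUnit_iff.1 hA with h | h
  · exact ⟨A, hA0, h, hAK⟩
  · refine ⟨A.updateRow 1 ((-1 : ℤ) • A 1), ?_, ?_, fun i j => ?_⟩
    · rw [updateRow_ne (by simp), hA0]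
    · rw [det_updateRow_smul, updateRow_eq_self, h]
      rfl
    · by_cases hi : i = 1
      · subst hi
        simpa using hAK 1 j
      · rw [updateRow_ne hi]
        exact hAK i j

/-- Completion of a generator `k ∈ 𝒢ⁿ` to a matrix `A ∈ SL(n,ℤ)` whose first row is `k`,
whose remaining rows `Â` have entries bounded by `|k|_∞`, with `|A|_∞ = |k|_∞` and
`|A⁻¹|_∞ ≤ (n-1)^{(n-1)/2} |k|_∞^{n-1}`. -/
theorem stmt_14 (n : ℕ) (hn : 2 ≤ n) (k : Fin n → ℤ) (hk : k ∈ gen n) :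
    ∃ A B : Matrix (Fin n) (Fin n) ℤ,
      (∀ j, A ⟨0, by omega⟩ j = k j) ∧
      A.det = 1 ∧
      (∀ i j, i ≠ ⟨0, by omega⟩ → (A i j).natAbs ≤ kinf k) ∧
      (∀ i j, (A i j).natAbs ≤ kinf k) ∧ (∃ i j, (A i j).natAbs = kinf k) ∧
      A * B = 1 ∧ B * A = 1 ∧
      (∀ i j, ((B i j).natAbs : ℝ) ≤
        ((n : ℝ) - 1) ^ (((n : ℝ) - 1)/2) * (kinf k : ℝ)^(n-1)) := by
  obtain ⟨n, rfl⟩ := Nat.exists_eq_add_of_le' hn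
  have hkK (i) : (k i).natAbs ≤ kinf k :=
    Finset.le_sup (f := fun i => (k i).natAbs) (Finset.mem_univ i)
  have hprim (d : ℤ) (hd : ∀ i, d ∣ k i) : IsUnit d := by
    rw [Int.isUnit_iff_natAbs_eq, ← Nat.dvd_one, ← hk.2]
    exact Finset.dvd_gcd fun i _ => Int.natAbs_dvd_natAbs.2 (hd i)
  obtain ⟨A, hA0, hdet, hAK⟩ := exists_det_eq_one_of_primitive k (kinf k) hprim
    fun i => by rw [Int.abs_eq_natAbs]; exact_mod_cast hkK i
  have hAK' (i j) : (A i j).natAbs ≤ kinf k := by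
    have := hAK i j
    rw [Int.abs_eq_natAbs] at this
    exact_mod_cast this
  obtain ⟨j, -, hj⟩ := Finset.exists_mem_eq_sup Finset.univ Finset.univ_nonempty
    fun i => (k i).natAbs
  refine ⟨A, A.adjugate, fun j => congrFun hA0 j, hdet, fun i j _ => hAK' i j, hAK',
    ⟨0, j, by rw [hA0]; exact hj.symm⟩, by rw [mul_adjugate, hdet, one_smul],
    by rw [adjugate_mul, hdet, one_smul], fun i j => ?_⟩
  have hB : |((A.adjugate i j : ℤ) : ℝ)| =
      |((A.submatrix j.succAbove i.succAbove).map (Int.castRingHom ℝ)).det| := by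
    rw [adjugate_fin_succ_eq_det_submatrix, ← RingHom.mapMatrix_apply, ← RingHom.map_det]
    simp [abs_mul]
  have hn1 : ((n + 2 : ℕ) : ℝ) - 1 = ((n + 1 : ℕ) : ℝ) := by
    push_cast
    ring
  rw [Nat.cast_natAbs, Int.cast_abs, hB, hn1]
  refine abs_det_le_rpow_of_abs_le _ (Nat.cast_nonneg _) fun i' j' => ?_
  simpa using (by exact_mod_cast hAK (j.succAbove i') (i.succAbove j') :
    |((A (j.succAbove i') (i.succAbove j') : ℤ) : ℝ)| ≤ (kinf k : ℝ))
end
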